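/- arXiv:math/0602277 — 2 statements merged into one kernel-verified Lean document; each statement's English description precedes it below -/
import Mathlib

section
/- Let X be a second-countable locally compact Hausdorff topological space. Then there exists a countable family 𝓕 of test functions on X such that every test function on X is the pointwise limit of some pointwise nondecreasing sequence of members of 𝓕. -/
open Filter Topology

/-- A test function: a nonnegative continuous real-valued function with compact support. -/
def IsTestFun {X : Type*} [TopologicalSpace X] (h : X → ℝ) : Prop :=
  Continuous h ∧ HasCompactSupport h ∧ ∀ x, 0 ≤ h x

theorem Set.Countable.supClosure {α : Type*} [SemilatticeSup α] {B : Set α} (hB : B.Countable) :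
    (_root_.supClosure B).Countable := by
  have hfin : {t : Set α | t.Finite ∧ t ⊆ B}.Countable := Set.countable_ofPred_finite_subset hB
  have hlub : _root_.supClosure B ⊆ ⋃ t ∈ {t : Set α | t.Finite ∧ t ⊆ B}, {a | IsLUB t a} := by
    rintro a ⟨t, ht, htB, rfl⟩
    exact Set.mem_biUnion (show (t : Set α) ∈ _ from ⟨t.finite_toSet, htB⟩) (t.isLUB_sup' ht)
  exact (hfin.biUnion fun t _ =>
    Set.Subsingleton.countable fun _ ha _ hb => ha.unique hb).mono hlub

theorem SupClosed.partialSups_mem {α : Type*} [SemilatticeSup α] {S : Set α} (hS : SupClosed S)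
    {u : ℕ → α} (hu : ∀ n, u n ∈ S) (n : ℕ) : partialSups u n ∈ S := by
  induction n with
  | zero => simpa using hu 0
  | succ n ih => rw [partialSups_add_one]; exact hS ih (hu _)

theorem IsTestFun.sup {X : Type*} [TopologicalSpace X] {f g : X → ℝ}
    (hf : IsTestFun f) (hg : IsTestFun g) : IsTestFun (f ⊔ g) :=
  ⟨hf.1.sup hg.1, hf.2.1.comp₂_left (m := (· ⊔ ·)) hg.2.1 (sup_idem _),
    fun x => (hf.2.2 x).trans le_sup_left⟩

theorem IsTestFun.const_mul {X : Type*} [TopologicalSpace X] {f : X → ℝ}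
    (hf : IsTestFun f) {c : ℝ} (hc : 0 ≤ c) : IsTestFun fun x => c * f x :=
  ⟨continuous_const.mul hf.1, hf.2.1.comp_left (g := (c * ·)) (mul_zero c),
    fun x => mul_nonneg hc (hf.2.2 x)⟩

theorem isTestFun_zero {X : Type*} [TopologicalSpace X] : IsTestFun (0 : X → ℝ) :=
  ⟨continuous_zero, HasCompactSupport.zero, fun _ => le_rfl⟩

theorem isTestFun_supClosed {X : Type*} [TopologicalSpace X] :
    SupClosed {f : X → ℝ | IsTestFun f} :=
  fun _ hf _ hg => IsTestFun.sup hf hg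

/-- A test function with values in `[0, 1]`, equal to `1` on `U` and vanishing outside `V`. -/
def IsBump {X : Type*} [TopologicalSpace X] (U V : Set X) (φ : X → ℝ) : Prop :=
  IsTestFun φ ∧ (∀ x, φ x ≤ 1) ∧ (∀ x ∈ U, φ x = 1) ∧ ∀ x ∉ V, φ x = 0

theorem TopologicalSpace.IsTopologicalBasis.exists_isBump {X : Type*} [TopologicalSpace X]
    [LocallyCompactSpace X] [T2Space X] {b : Set (Set X)} (hb : IsTopologicalBasis b)
    {x : X} {V : Set X} (hV : IsOpen V) (hx : x ∈ V) :
    ∃ U ∈ b, x ∈ U ∧ ∃ φ : X → ℝ, IsBump U V φ := by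
  obtain ⟨K, hK, hxK, hKV⟩ := exists_compact_subset hV hx
  obtain ⟨U, hUb, hxU, hUK⟩ := hb.exists_subset_of_mem_open hxK isOpen_interior
  obtain ⟨φ, h1, h0, hsupp, hφ⟩ := exists_continuous_one_zero_of_isCompact hK
    hV.isClosed_compl (Set.disjoint_compl_right_iff_subset.2 hKV)
  exact ⟨U, hUb, hxU, φ, ⟨φ.continuous, hsupp, fun y => (hφ y).1⟩, fun y => (hφ y).2,
    fun y hy => h1 (interior_subset (hUK hy)), fun y hy => h0 hy⟩

/-- There is a countable set of test functions such that every test function is the pointwise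
supremum of the members of the set lying below it. -/
theorem exists_countable_testFun_approx (X : Type*) [TopologicalSpace X]
    [SecondCountableTopology X] [LocallyCompactSpace X] [T2Space X] :
    ∃ B : Set (X → ℝ), B.Countable ∧ (∀ f ∈ B, IsTestFun f) ∧ 0 ∈ B ∧
      ∀ h : X → ℝ, IsTestFun h → ∀ x, ∀ a < h x, ∃ f ∈ B, f ≤ h ∧ a < f x := by
  let b := TopologicalSpace.countableBasis X
  have hb := TopologicalSpace.isBasis_countableBasis X
  have hex : ∀ p : Set X × Set X, ∃ φ : X → ℝ, IsTestFun φ ∧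
      ((∃ ψ : X → ℝ, IsBump p.1 p.2 ψ) → IsBump p.1 p.2 φ) := fun p => by
    by_cases hp : ∃ ψ : X → ℝ, IsBump p.1 p.2 ψ
    · obtain ⟨ψ, hψ⟩ := hp
      exact ⟨ψ, hψ.1, fun _ => hψ⟩
    · exact ⟨0, isTestFun_zero, fun h => absurd h hp⟩
  choose φ hφ hbump using hex
  let g : (Set X × Set X) × ℚ → X → ℝ := fun p x => p.2 * φ p.1 x
  have hbc : b.Countable := TopologicalSpace.countable_countableBasis X
  refine ⟨insert 0 (g '' ((b ×ˢ b) ×ˢ {q : ℚ | 0 ≤ q})),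
    (((hbc.prod hbc).prod (Set.to_countable _)).image g).insert 0, ?_, Set.mem_insert _ _, ?_⟩
  · rintro f (rfl | ⟨p, ⟨-, hq⟩, rfl⟩)
    · exact isTestFun_zero
    · exact (hφ p.1).const_mul (by exact_mod_cast hq)
  · intro h hh x a ha
    rcases lt_or_ge a 0 with ha0 | ha0
    · exact ⟨0, Set.mem_insert _ _, hh.2.2, ha0⟩
    obtain ⟨q, haq, hqh⟩ := exists_rat_btwn ha
    have hq : (0 : ℝ) ≤ q := ha0.trans haq.le
    obtain ⟨V, hVb, hxV, hVh⟩ := hb.exists_subset_of_mem_open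
      (show x ∈ {y | (q : ℝ) < h y} from hqh) (isOpen_lt continuous_const hh.1)
    obtain ⟨U, hUb, hxU, hψ⟩ := hb.exists_isBump (hb.isOpen hVb) hxV
    obtain ⟨-, hle, h1, h0⟩ := hbump (U, V) hψ
    refine ⟨g ((U, V), q), Set.mem_insert_of_mem _
      ⟨_, ⟨⟨hUb, hVb⟩, by exact_mod_cast hq⟩, rfl⟩, fun y => ?_, ?_⟩
    · by_cases hy : y ∈ V
      · exact (mul_le_of_le_one_right hq (hle y)).trans (hVh hy).le
      · simpa [g, h0 y hy] using hh.2.2 y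
    · simpa [g, h1 x hxU] using haq

/-- On a second-countable locally compact Hausdorff space there is a countable family of
test functions such that every test function is the pointwise limit of a pointwise
nondecreasing sequence of members of the family. -/
theorem exists_countable_testFun_family
    {X : Type*} [TopologicalSpace X] [SecondCountableTopology X]
    [LocallyCompactSpace X] [T2Space X] :
    ∃ F : Set (X → ℝ), F.Countable ∧ (∀ f ∈ F, IsTestFun f) ∧
      ∀ h : X → ℝ, IsTestFun h →
        ∃ s : ℕ → X → ℝ, (∀ n, s n ∈ F) ∧ Monotone s ∧
          ∀ x, Tendsto (fun n => s n x) atTop (𝓝 (h x)) := by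
  obtain ⟨B, hBc, hBt, hB0, hB⟩ := exists_countable_testFun_approx X
  refine ⟨supClosure B, hBc.supClosure, supClosure_min hBt isTestFun_supClosed, fun h hh => ?_⟩
  obtain ⟨u, hu⟩ := (hBc.mono (Set.sep_subset B (· ≤ h))).exists_eq_range ⟨0, hB0, hh.2.2⟩
  have hmem : ∀ n, u n ∈ B ∧ u n ≤ h := fun n => hu.ge (Set.mem_range_self n)
  refine ⟨partialSups u, supClosed_supClosure.partialSups_mem fun n =>
    subset_supClosure (hmem n).1, (partialSups u).monotone, fun x => ?_⟩
  refine tendsto_order.2 ⟨fun a ha => ?_, fun a ha => Eventually.of_forall fun n =>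
    (partialSups_le u n h (fun k _ => (hmem k).2) x).trans_lt ha⟩
  obtain ⟨f, hfB, hfh, haf⟩ := hB h hh x a ha
  obtain ⟨k, rfl⟩ : f ∈ Set.range u := hu.le ⟨hfB, hfh⟩
  filter_upwards [eventually_ge_atTop k] with n hn
  exact haf.trans_le (le_partialSups_of_le u hn x)
end

section
/- Let X and Y be second-countable locally compact Hausdorff topological spaces. Then every test function h on X × Y is the pointwise limit of a pointwise nondecreasing sequence (sₙ), where each sₙ is a finite sum of functions of the form (x,y) ↦ f(x)·g(y) with f a test function on X and g a test function on Y. -/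
open Filter Topology

namespace IsTestFun

variable {X Y : Type*} [TopologicalSpace X] [TopologicalSpace Y]

/-- A test function stays a test function after subtracting a smaller nonnegative continuous
function. -/
lemma sub {h t : X → ℝ} (hh : IsTestFun h) (ht : Continuous t) (ht0 : ∀ x, 0 ≤ t x)
    (hth : ∀ x, t x ≤ h x) : IsTestFun fun x => h x - t x := by
  refine ⟨hh.1.sub ht, hh.2.1.mono' fun x hx => subset_tsupport h fun h0 => hx ?_,
    fun x => sub_nonneg.2 (hth x)⟩
  have := ht0 x
  have := hth x
  dsimp only
  linarith

/-- Truncating a section of a test function from below at height `ε` gives a test function. -/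
lemma truncated_section [T2Space Y] {r : X × Y → ℝ} (hr : IsTestFun r) {ε : ℝ}
    (hε : 0 ≤ ε) (x : X) : IsTestFun fun y => max (r (x, y) - ε) 0 := by
  refine ⟨((hr.1.comp (.prodMk_right x)).sub continuous_const).max continuous_const,
    .intro (hr.2.1.isCompact.image continuous_snd) fun y hy => ?_, fun y => le_max_right _ _⟩
  have h0 : r (x, y) = 0 := image_eq_zero_of_notMem_tsupport fun hm => hy ⟨_, hm, rfl⟩
  simp [h0, hε]

/-- The sections of a test function depend continuously on the point, uniformly in the other
variable. -/
lemma exists_isOpen_forall_abs_sub_lt {r : X × Y → ℝ} (hr : IsTestFun r)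
    {ε : ℝ} (hε : 0 < ε) (a : X) :
    ∃ U : Set X, IsOpen U ∧ a ∈ U ∧ ∀ x ∈ U, ∀ y, |r (x, y) - r (a, y)| < ε := by
  have hcont : Continuous fun p : X × Y => |r p - r (a, p.2)| :=
    (hr.1.sub (hr.1.comp (continuous_const.prodMk continuous_snd))).abs
  obtain ⟨U, V, hU, -, haU, hLV, hUV⟩ := generalized_tube_lemma (isCompact_singleton (x := a))
    (hr.2.1.isCompact.image continuous_snd) (isOpen_lt hcont (continuous_const (y := ε)))
    (by rintro ⟨x, y⟩ ⟨rfl, -⟩; simpa using hε)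
  refine ⟨U, hU, haU rfl, fun x hx y => ?_⟩
  by_cases hy : y ∈ Prod.snd '' tsupport r
  · exact hUV (Set.mk_mem_prod hx (hLV hy))
  · have h0 (z : X) : r (z, y) = 0 := image_eq_zero_of_notMem_tsupport fun hm => hy ⟨_, hm, rfl⟩
    simpa [h0] using hε

end IsTestFun

/-- Finite sums of products of test functions of the separate variables. -/
def IsTestProdSum {X Y : Type*} [TopologicalSpace X] [TopologicalSpace Y]
    (s : X × Y → ℝ) : Prop :=
  ∃ (k : ℕ) (f : Fin k → X → ℝ) (g : Fin k → Y → ℝ),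
    (∀ i, IsTestFun (f i)) ∧ (∀ i, IsTestFun (g i)) ∧ s = fun p => ∑ i, f i p.1 * g i p.2

namespace IsTestProdSum

variable {X Y : Type*} [TopologicalSpace X] [TopologicalSpace Y] {s t : X × Y → ℝ}

lemma zero : IsTestProdSum (0 : X × Y → ℝ) :=
  ⟨0, Fin.elim0, Fin.elim0, fun i => i.elim0, fun i => i.elim0, by ext; simp⟩

lemma add (hs : IsTestProdSum s) (ht : IsTestProdSum t) : IsTestProdSum (s + t) := by
  obtain ⟨k, f, g, hf, hg, rfl⟩ := hs
  obtain ⟨l, f', g', hf', hg', rfl⟩ := ht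
  refine ⟨k + l, Fin.append f f', Fin.append g g', fun i => ?_, fun i => ?_, ?_⟩
  · induction i using Fin.addCases <;> simp [hf, hf']
  · induction i using Fin.addCases <;> simp [hg, hg']
  · ext p
    simp [Fin.sum_univ_add]

lemma continuous (hs : IsTestProdSum s) : Continuous s := by
  obtain ⟨k, f, g, hf, hg, rfl⟩ := hs
  exact continuous_finsetSum _ fun i _ =>
    ((hf i).1.comp continuous_fst).mul ((hg i).1.comp continuous_snd)

lemma nonneg (hs : IsTestProdSum s) (p : X × Y) : 0 ≤ s p := by
  obtain ⟨k, f, g, hf, hg, rfl⟩ := hs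
  exact Finset.sum_nonneg fun i _ => mul_nonneg ((hf i).2.2 _) ((hg i).2.2 _)

end IsTestProdSum

/-- Every test function on a product can be uniformly approximated from below by finite sums of
products of test functions. -/
lemma IsTestFun.exists_isTestProdSum_le {X Y : Type*} [TopologicalSpace X]
    [LocallyCompactSpace X] [T2Space X] [TopologicalSpace Y] [T2Space Y]
    {r : X × Y → ℝ} (hr : IsTestFun r) {ε : ℝ} (hε : 0 < ε) :
    ∃ t : X × Y → ℝ, IsTestProdSum t ∧ ∀ p, t p ≤ r p ∧ r p ≤ t p + 2 * ε := by
  choose U hUo hU hUr using hr.exists_isOpen_forall_abs_sub_lt hε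
  have hK : IsCompact (Prod.fst '' tsupport r) := hr.2.1.isCompact.image continuous_fst
  obtain ⟨c, -, hc⟩ := hK.elim_nhds_subcover U fun x _ => (hUo x).mem_nhds (hU x)
  let a : Fin c.card → X := fun i => c.equivFin.symm i
  obtain ⟨f, hfU, hf1, hf01, hfc⟩ := exists_continuous_sum_one_of_isOpen_isCompact
    (s := fun i => U (a i)) (fun i => hUo _) hK (fun x hx => by
      obtain ⟨z, hz, hxz⟩ := Set.mem_iUnion₂.1 (hc hx)
      exact Set.mem_iUnion.2 ⟨c.equivFin ⟨z, hz⟩, by simpa [a] using hxz⟩)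
  refine ⟨_, ⟨c.card, fun i => f i, fun i y => max (r (a i, y) - ε) 0,
    fun i => ⟨(f i).continuous, hfc i, fun x => (hf01 i x).1⟩,
    fun i => hr.truncated_section hε.le (a i), rfl⟩, ?_⟩
  rintro ⟨x, y⟩
  have hbound (i : Fin c.card) : f i x * max (r (a i, y) - ε) 0 ≤ f i x * r (x, y) ∧
      f i x * (r (x, y) - 2 * ε) ≤ f i x * max (r (a i, y) - ε) 0 := by
    by_cases hx : f i x = 0
    · simp [hx]
    have hlt := abs_lt.1 (hUr (a i) x (hfU i (subset_tsupport _ hx)) y)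
    exact ⟨mul_le_mul_of_nonneg_left (max_le (by linarith) (hr.2.2 _)) (hf01 i x).1,
      mul_le_mul_of_nonneg_left (le_max_of_le_left (by linarith)) (hf01 i x).1⟩
  by_cases hx : x ∈ Prod.fst '' tsupport r
  · have hsum : ∑ i, f i x = 1 := by simpa using hf1 hx
    have hle := Finset.sum_le_sum fun i (_ : i ∈ Finset.univ) => (hbound i).1
    have hge := Finset.sum_le_sum fun i (_ : i ∈ Finset.univ) => (hbound i).2
    rw [← Finset.sum_mul, hsum, one_mul] at hle hge
    exact ⟨hle, by dsimp only; linarith⟩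
  · have h0 : r (x, y) = 0 := image_eq_zero_of_notMem_tsupport fun hm => hx ⟨_, hm, rfl⟩
    refine ⟨(Finset.sum_le_sum fun i _ => (hbound i).1).trans (by simp [h0]), ?_⟩
    rw [h0]
    exact add_nonneg (Finset.sum_nonneg fun i _ => mul_nonneg (hf01 i x).1 (le_max_right _ _))
      (by positivity)

/-- Every test function on a product of two second-countable locally compact Hausdorff
spaces is the pointwise nondecreasing limit of finite sums of products of test functions
of the separate variables. -/
theorem testFun_prod_approx
    {X Y : Type*} [TopologicalSpace X] [SecondCountableTopology X]
    [LocallyCompactSpace X] [T2Space X]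
    [TopologicalSpace Y] [SecondCountableTopology Y]
    [LocallyCompactSpace Y] [T2Space Y]
    (h : X × Y → ℝ) (hh : IsTestFun h) :
    ∃ s : ℕ → X × Y → ℝ, Monotone s ∧
      (∀ n, ∃ (k : ℕ) (f : Fin k → X → ℝ) (g : Fin k → Y → ℝ),
        (∀ i, IsTestFun (f i)) ∧ (∀ i, IsTestFun (g i)) ∧
        s n = fun p => ∑ i, f i p.1 * g i p.2) ∧
      ∀ p : X × Y, Tendsto (fun n => s n p) atTop (𝓝 (h p)) := by
  have step (s : {s : X × Y → ℝ // IsTestProdSum s ∧ s ≤ h}) (n : ℕ) :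
      ∃ s' : {s : X × Y → ℝ // IsTestProdSum s ∧ s ≤ h},
        s.1 ≤ s'.1 ∧ ∀ p, h p ≤ s'.1 p + 2 * (1 / ((n : ℝ) + 1)) := by
    obtain ⟨s, hs, hsh⟩ := s
    obtain ⟨t, ht, htr⟩ := (hh.sub hs.continuous hs.nonneg hsh).exists_isTestProdSum_le
      (Nat.one_div_pos_of_nat (α := ℝ) (n := n))
    refine ⟨⟨s + t, hs.add ht, fun p => ?_⟩, fun p => ?_, fun p => ?_⟩
    · have := (htr p).1
      simp only [Pi.add_apply]
      linarith
    · simpa using ht.nonneg p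
    · have := (htr p).2
      simp only [Pi.add_apply]
      linarith
  choose next hmono happrox using step
  let s : ℕ → {s : X × Y → ℝ // IsTestProdSum s ∧ s ≤ h} := fun n =>
    n.rec ⟨0, .zero, hh.2.2⟩ fun n s => next s n
  refine ⟨fun n => (s n).1, monotone_nat_of_le_succ fun n => hmono (s n) n,
    fun n => (s n).2.1, fun p => ?_⟩
  rw [← tendsto_add_atTop_iff_nat 1]
  refine tendsto_of_tendsto_of_tendsto_of_le_of_le (g := fun n : ℕ => h p - 2 * (1 / ((n : ℝ) + 1)))
    ?_ tendsto_const_nhds (fun n => ?_) fun n => (s (n + 1)).2.2 p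
  · simpa using tendsto_const_nhds.sub
      ((tendsto_one_div_add_atTop_nhds_zero_nat (𝕜 := ℝ)).const_mul 2)
  · exact sub_le_iff_le_add.2 (happrox (s n) n p)
end
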